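/- If g is moreover nondecreasing on [t,∞) and there exist θ₀, θ₁ ≥ t with a·g(θ₀) ≤ r·c ≤ a·g(θ₁), then there exists θ⋆ ≥ t with a·g(θ⋆) = r·c, and H attains its global infimum over [t,∞) at θ⋆, i.e., H(θ⋆) = inf_{θ≥t} H(θ). -/

import Mathlib

/-- Derivative of an exponentially discounted lump-sum cost plus discounted running cost. -/
theorem hasDerivAt_discounted_cost (t r c a : ℝ) {g : ℝ → ℝ} (hg : Continuous g) (x : ℝ) :
    HasDerivAt
      (fun θ : ℝ => c * Real.exp (-r * (θ - t)) +
        a * ∫ u in t..θ, g u * Real.exp (-r * (u - t)))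
      (Real.exp (-r * (x - t)) * (a * g x - r * c)) x := by
  have hcont : Continuous fun u : ℝ => g u * Real.exp (-r * (u - t)) := by fun_prop
  have hlin : HasDerivAt (fun θ : ℝ => -r * (θ - t)) (-r) x := by
    simpa using ((hasDerivAt_id x).sub_const t).const_mul (-r)
  have hint := (hcont.integral_hasStrictDerivAt t x).hasDerivAt
  exact ((hlin.exp.const_mul c).add (hint.const_mul a)).congr_deriv (by ring)

/-- A function that decreases up to `b` and increases after `b` is minimal at `b`. -/
theorem isMinOn_Ici_of_hasDerivAt {f f' : ℝ → ℝ} {t b : ℝ} (hb : t ≤ b)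
    (hf : ∀ x, HasDerivAt f (f' x) x) (hneg : ∀ x ∈ Set.Icc t b, f' x ≤ 0)
    (hpos : ∀ x ∈ Set.Ici b, 0 ≤ f' x) : IsMinOn f (Set.Ici t) b := by
  have hc : Continuous f := continuous_iff_continuousAt.2 fun x => (hf x).continuousAt
  have hanti : AntitoneOn f (Set.Icc t b) :=
    antitoneOn_of_hasDerivWithinAt_nonpos (convex_Icc t b) hc.continuousOn
      (fun x _ => (hf x).hasDerivWithinAt) fun x hx => hneg x (interior_subset hx)
  have hmono : MonotoneOn f (Set.Ici b) :=
    monotoneOn_of_hasDerivWithinAt_nonneg (convex_Ici b) hc.continuousOn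
      (fun x _ => (hf x).hasDerivWithinAt) fun x hx => hpos x (interior_subset hx)
  intro x hx
  rcases le_total x b with h | h
  · exact hanti ⟨hx, h⟩ ⟨hb, le_rfl⟩ h
  · exact hmono (Set.mem_Ici.2 le_rfl) h h

/-- If moreover `g` is nondecreasing on `[t,∞)` and there are `θ₀, θ₁ ≥ t` with
`a·g(θ₀) ≤ r·c ≤ a·g(θ₁)`, then there exists `θ⋆ ≥ t` with `a·g(θ⋆) = r·c`, and the
discounted renovation-cost functional `H` attains its global infimum over `[t,∞)`
at `θ⋆`. -/
theorem infimum_attained_at_first_order_condition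
    (t r c a : ℝ) (hr : 0 < r) (hc : 0 < c) (ha : 0 < a)
    (g : ℝ → ℝ) (hg : Continuous g)
    (H : ℝ → ℝ)
    (hH : ∀ θ : ℝ, H θ =
      c * Real.exp (-r * (θ - t)) + a * ∫ u in t..θ, g u * Real.exp (-r * (u - t)))
    (hmono : MonotoneOn g (Set.Ici t))
    (θ₀ θ₁ : ℝ) (hθ₀ : t ≤ θ₀) (hθ₁ : t ≤ θ₁)
    (h₀ : a * g θ₀ ≤ r * c) (h₁ : r * c ≤ a * g θ₁) :
    ∃ θs : ℝ, t ≤ θs ∧ a * g θs = r * c ∧ H θs = sInf (H '' Set.Ici t) := by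
  obtain ⟨θs, hθs, heq⟩ : r * c ∈ (fun x => a * g x) '' Set.Ici t :=
    isPreconnected_Ici.intermediate_value hθ₀ hθ₁ (hg.const_mul a).continuousOn ⟨h₀, h₁⟩
  have heq' : a * g θs = r * c := heq
  have hderiv : ∀ x, HasDerivAt H (Real.exp (-r * (x - t)) * (a * g x - r * c)) x := by
    rw [funext hH]
    exact hasDerivAt_discounted_cost t r c a hg
  have hmin : IsMinOn H (Set.Ici t) θs := isMinOn_Ici_of_hasDerivAt hθs hderiv
    (fun x hx => mul_nonpos_of_nonneg_of_nonpos (Real.exp_pos _).le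
      (by linarith [mul_le_mul_of_nonneg_left (hmono hx.1 hθs hx.2) ha.le]))
    (fun x hx => mul_nonneg (Real.exp_pos _).le
      (by linarith [mul_le_mul_of_nonneg_left (hmono hθs (Set.Ici_subset_Ici.2 hθs hx) hx) ha.le]))
  have hleast : IsLeast (H '' Set.Ici t) (H θs) :=
    ⟨Set.mem_image_of_mem H hθs, Set.forall_mem_image.2 fun _ hx => hmin hx⟩
  exact ⟨θs, hθs, heq', hleast.csInf_eq.symm⟩
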